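/- arXiv:2005.13915 — 2 statements merged into one kernel-verified Lean document; each statement's English description precedes it below -/
import Mathlib

section
/- There are absolute constants C₀ and, for each j ∈ ℕ₀, constants C_j, such that for every T ≥ 1 there exists a family of smooth functions Δ_c : ℝ∖{0} → ℝ, indexed by c ∈ ℕ, with the following properties: (i) Δ_c = 0 identically whenever c > C₀ T^{1/2}; (ii) for every j ∈ ℕ₀ and every real x with 0 < |x| ≤ T, |d^j Δ_c / dx^j (x)| ≤ C_j T^{−1/2} |x|^{−j}, and each Δ_c extends continuously to 0 with |Δ_c(0)| ≤ C₀ T^{−1/2}; (iii) for every integer n with |n| ≤ T, one has 1_{n = 0} = Σ_{c ≤ C₀ T^{1/2}} (1/c) Σ_{a mod c, gcd(a, c) = 1} e(an/c) Δ_c(n). -/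
/-- The Ramanujan-type exponential sum `Σ_{a mod c, (a,c)=1} e(an/c)`. -/
noncomputable def ramanujanSum (c : ℕ) (n : ℤ) : ℂ :=
  if h : c ≠ 0 then
    haveI : NeZero c := ⟨h⟩
    ∑ a : (ZMod c)ˣ, Complex.exp (2 * Real.pi * Complex.I *
      (((((a : ZMod c).val : ℤ) * n) : ℤ) : ℂ) / (c : ℂ))
  else 0

open scoped ContDiff in
lemma exists_psi : ∃ ψ : ℝ → ℝ, ContDiff ℝ ∞ ψ ∧ (∀ x, ψ (-x) = ψ x) ∧ (∀ x, 0 ≤ ψ x) ∧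
    (∀ x, ψ x ≤ 1) ∧ (∀ x, 5/4 ≤ x → x ≤ 7/4 → ψ x = 1) ∧
    (∀ j x, iteratedDeriv j ψ x ≠ 0 → 1 ≤ |x| ∧ |x| ≤ 2) ∧
    ∃ M : ℕ → ℝ, ∀ j x, |iteratedDeriv j ψ x| ≤ M j := by
  let b : ContDiffBump (5/2 : ℝ) := ⟨1, 3/2, by norm_num, by norm_num⟩
  have hψ : ContDiff ℝ ∞ (fun x : ℝ => b (x ^ 2)) := b.contDiff.comp (contDiff_id.pow 2)
  have hsub : ∀ j x, iteratedDeriv j (fun x : ℝ => b (x ^ 2)) x ≠ 0 → 1 ≤ |x| ∧ |x| ≤ 2 := by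
    intro j x hx
    have h1 : x ∈ tsupport (fun x : ℝ => b (x ^ 2)) := by
      apply support_iteratedFDeriv_subset (𝕜 := ℝ) j
      intro h0
      apply hx
      rw [iteratedDeriv_eq_iteratedFDeriv, h0]
      rfl
    have h2 : tsupport (fun x : ℝ => b (x ^ 2)) ⊆ {x : ℝ | 1 ≤ |x| ∧ |x| ≤ 2} := by
      apply closure_minimal
      · intro y hy
        have : y ^ 2 ∈ Function.support b := hy
        rw [b.support_eq, Metric.mem_ball, Real.dist_eq, abs_lt] at this
        have h3 : -(3/2) < y ^ 2 - 5/2 := this.1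
        have h4 : y ^ 2 - 5/2 < 3/2 := this.2
        rw [← sq_abs] at h3 h4
        constructor <;> nlinarith [abs_nonneg y]
      · exact (isClosed_le continuous_const continuous_abs).inter
          (isClosed_le continuous_abs continuous_const)
    exact h2 h1
  refine ⟨fun x => b (x ^ 2), hψ, ?_, fun x => b.nonneg, fun x => b.le_one, ?_, hsub, ?_⟩
  · intro x; simp
  · intro x h1 h2
    apply b.one_of_mem_closedBall
    rw [Metric.mem_closedBall, Real.dist_eq, abs_le]
    change -1 ≤ _ ∧ _ ≤ (1:ℝ)
    constructor <;> nlinarith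
  · have : ∀ j, ∃ M, ∀ x, |iteratedDeriv j (fun x : ℝ => b (x ^ 2)) x| ≤ M := by
      intro j
      have hc : Continuous (iteratedDeriv j (fun x : ℝ => b (x ^ 2))) :=
        hψ.continuous_iteratedDeriv j (by exact_mod_cast le_top)
      obtain ⟨M, hM⟩ := (isCompact_Icc (a := (-2:ℝ)) (b := 2)).exists_bound_of_continuousOn
        hc.continuousOn
      refine ⟨max M 0, fun x => ?_⟩
      by_cases h : iteratedDeriv j (fun x : ℝ => b (x ^ 2)) x = 0
      · rw [h]; simp
      · exact le_max_of_le_left (hM x (abs_le.1 (hsub j x h).2))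
    choose M hM using this
    exact ⟨M, hM⟩

lemma sum_bound (N c : ℕ) (A B : ℝ) (hA : 0 < A) (hB : 0 ≤ B) (F : ℕ → ℝ)
    (hF : ∀ d, 1 ≤ d → |F d| ≤ B) (hs : ∀ d, 1 ≤ d → F d ≠ 0 → A ≤ d ∧ (d:ℝ) ≤ 2 * A) :
    |∑ d ∈ (Finset.Icc 1 N).filter (c ∣ ·), ((c:ℝ) / d) * F d| ≤ 2 * B := by
  rcases Nat.eq_zero_or_pos c with rfl | hc
  · simpa using hB
  have hc' : (0:ℝ) < c := by exact_mod_cast hc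
  set s := (Finset.Ioc 0 ⌊2 * A⌋₊).filter (c ∣ ·) with hsdef
  calc |∑ d ∈ (Finset.Icc 1 N).filter (c ∣ ·), ((c:ℝ) / d) * F d|
      ≤ ∑ d ∈ (Finset.Icc 1 N).filter (c ∣ ·), |((c:ℝ) / d) * F d| := Finset.abs_sum_le_sum_abs _ _
    _ ≤ ∑ d ∈ (Finset.Icc 1 N).filter (c ∣ ·), if d ∈ s then (c / A) * B else 0 := by
        apply Finset.sum_le_sum
        intro d hd
        simp only [Finset.mem_filter, Finset.mem_Icc] at hd
        by_cases h0 : F d = 0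
        · rw [h0]; simp; split_ifs <;> positivity
        · obtain ⟨h1, h2⟩ := hs d hd.1.1 h0
          have : d ∈ s := by
            simp only [hsdef, Finset.mem_filter, Finset.mem_Ioc]
            exact ⟨⟨hd.1.1, Nat.le_floor h2⟩, hd.2⟩
          rw [if_pos this, abs_mul, abs_of_nonneg (by positivity)]
          gcongr
          exact hF d hd.1.1
    _ ≤ ∑ d ∈ s, (c / A) * B := by
        rw [← Finset.sum_filter]
        apply Finset.sum_le_sum_of_subset_of_nonneg
        · intro d hd; exact (Finset.mem_filter.1 hd).2
        · intros; positivity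
    _ = ((⌊2 * A⌋₊ / c : ℕ) : ℝ) * (c / A * B) := by
        rw [Finset.sum_const, hsdef, Nat.Ioc_filter_dvd_card_eq_div, nsmul_eq_mul]
    _ ≤ (2 * A / c) * (c / A * B) := by
        gcongr
        refine Nat.cast_div_le.trans ?_
        gcongr
        exact Nat.floor_le (by positivity)
    _ = 2 * B := by field_simp

lemma ramanujan_eq (c : ℕ) (hc : c ≠ 0) (n : ℤ) :
    ramanujanSum c n = ∑ z ∈ primitiveRoots c ℂ, z ^ n := by
  have : NeZero c := ⟨hc⟩
  have hc' : (c:ℂ) ≠ 0 := by exact_mod_cast hc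
  rw [ramanujanSum, dif_pos hc]
  have key := Complex.isPrimitiveRoot_exp c hc
  have hexp : ∀ k : ℕ, Complex.exp (2 * Real.pi * Complex.I / c) ^ k
      = Complex.exp (2 * Real.pi * Complex.I * (k / c)) := by
    intro k; rw [← Complex.exp_nat_mul]; congr 1; ring
  refine Finset.sum_bij (fun a _ => Complex.exp (2 * Real.pi * Complex.I / c) ^ (a : ZMod c).val)
    ?_ ?_ ?_ ?_
  · intro a _
    rw [mem_primitiveRoots (Nat.pos_of_ne_zero hc), hexp]
    exact Complex.isPrimitiveRoot_exp_of_coprime _ _ hc (ZMod.val_coe_unit_coprime a)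
  · intro a _ b _ h
    have := key.pow_inj (ZMod.val_lt _) (ZMod.val_lt _) h
    exact Units.ext (ZMod.val_injective c this)
  · intro z hz
    rw [mem_primitiveRoots (Nat.pos_of_ne_zero hc), Complex.isPrimitiveRoot_iff _ _ hc] at hz
    obtain ⟨i, hi, hic, rfl⟩ := hz
    refine ⟨ZMod.unitOfCoprime i hic, Finset.mem_univ _, ?_⟩
    rw [hexp, ZMod.coe_unitOfCoprime, ZMod.val_natCast_of_lt hi]
  · intro a _
    rw [hexp, ← Complex.exp_int_mul]
    congr 1
    push_cast
    ring

lemma sum_ramanujan (d : ℕ) (hd : d ≠ 0) (n : ℤ) :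
    ∑ c ∈ d.divisors, ramanujanSum c n = if (d:ℤ) ∣ n then (d:ℂ) else 0 := by
  classical
  have hdp := Nat.pos_of_ne_zero hd
  have key := Complex.isPrimitiveRoot_exp d hd
  set ζ := Complex.exp (2 * Real.pi * Complex.I / d) with hζ
  have h1 : ∑ c ∈ d.divisors, ramanujanSum c n
      = ∑ z ∈ Polynomial.nthRootsFinset d (1:ℂ), z ^ n := by
    rw [IsPrimitiveRoot.nthRoots_one_eq_biUnion_primitiveRoots, Finset.sum_biUnion]
    · exact Finset.sum_congr rfl fun c hc => ramanujan_eq c (Nat.pos_of_mem_divisors hc).ne' n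
    · intro a _ b _ hab
      exact IsPrimitiveRoot.disjoint hab
  rw [h1]
  split_ifs with h
  · obtain ⟨k, rfl⟩ := h
    rw [Finset.sum_congr rfl (g := fun _ => (1:ℂ)), Finset.sum_const, key.card_nthRootsFinset]
    · simp
    · intro z hz
      rw [Polynomial.mem_nthRootsFinset hdp] at hz
      rw [zpow_mul, zpow_natCast, hz, one_zpow]
  · have hne : ζ ^ n ≠ 1 := fun h' => h ((key.zpow_eq_one_iff_dvd n).1 h')
    have hz0 : ζ ≠ 0 := Complex.exp_ne_zero _
    have hmul : ζ ^ n * ∑ z ∈ Polynomial.nthRootsFinset d (1:ℂ), z ^ n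
        = ∑ z ∈ Polynomial.nthRootsFinset d (1:ℂ), z ^ n := by
      rw [Finset.mul_sum]
      refine Finset.sum_bij (fun z _ => ζ * z) ?_ ?_ ?_ ?_
      · intro z hz
        rw [Polynomial.mem_nthRootsFinset hdp] at hz ⊢
        rw [mul_pow, hz, key.pow_eq_one, one_mul]
      · intro a _ b _ hab
        exact mul_left_cancel₀ hz0 hab
      · intro z hz
        refine ⟨ζ⁻¹ * z, ?_, by field_simp⟩
        rw [Polynomial.mem_nthRootsFinset hdp] at hz ⊢
        rw [mul_pow, hz, inv_pow, key.pow_eq_one, inv_one, one_mul]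
      · intro z _
        rw [mul_zpow]
    by_contra h0
    exact hne (mul_right_cancel₀ h0 (hmul.trans (one_mul _).symm))

lemma sum_swap (N : ℕ) (n : ℤ) (f : ℕ → ℂ) :
    ∑ c ∈ Finset.Icc 1 N, (1 / (c:ℂ)) * ramanujanSum c n *
      ∑ d ∈ (Finset.Icc 1 N).filter (c ∣ ·), ((c:ℂ) / d) * f d
    = ∑ d ∈ Finset.Icc 1 N, if (d:ℤ) ∣ n then f d else 0 := by
  simp_rw [Finset.mul_sum, Finset.sum_filter]
  rw [Finset.sum_comm]
  refine Finset.sum_congr rfl fun d hd => ?_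
  have hd0 : d ≠ 0 := by have := (Finset.mem_Icc.1 hd).1; omega
  have hd' : (d:ℂ) ≠ 0 := by exact_mod_cast hd0
  rw [← Finset.sum_filter]
  have : (Finset.Icc 1 N).filter (· ∣ d) = d.divisors := by
    ext c
    simp only [Finset.mem_filter, Finset.mem_Icc, Nat.mem_divisors] at hd ⊢
    constructor
    · rintro ⟨_, h⟩; exact ⟨h, hd0⟩
    · rintro ⟨h, _⟩
      exact ⟨⟨Nat.pos_of_dvd_of_pos h (by omega), (Nat.le_of_dvd (by omega) h).trans hd.2⟩, h⟩
  rw [this]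
  trans ∑ c ∈ d.divisors, ramanujanSum c n * (f d / d)
  · refine Finset.sum_congr rfl fun c hc => ?_
    have : (c:ℂ) ≠ 0 := by exact_mod_cast (Nat.pos_of_mem_divisors hc).ne'
    field_simp
  · rw [← Finset.sum_mul, sum_ramanujan d hd0 n]
    split_ifs
    · field_simp
    · simp

/-- **The Duke–Friedlander–Iwaniec delta symbol** (Lemma 7.3). -/
theorem delta_symbol_exists :
    ∃ C₀ : ℝ, 0 < C₀ ∧ ∃ Cj : ℕ → ℝ, ∀ T : ℝ, 1 ≤ T →
      ∃ Δ : ℕ → ℝ → ℝ,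
        (∀ c : ℕ, C₀ * Real.sqrt T < (c : ℝ) → ∀ x : ℝ, Δ c x = 0) ∧
        (∀ c : ℕ, ContDiffOn ℝ (⊤ : ℕ∞) (Δ c) {x : ℝ | x ≠ 0}) ∧
        (∀ c : ℕ, ∀ j : ℕ, ∀ x : ℝ, x ≠ 0 → |x| ≤ T →
          |iteratedDeriv j (Δ c) x| ≤ Cj j * T ^ (-(1 : ℝ) / 2) * |x| ^ (-(j : ℝ))) ∧
        (∀ c : ℕ, ContinuousAt (Δ c) 0 ∧ |Δ c 0| ≤ C₀ * T ^ (-(1 : ℝ) / 2)) ∧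
        (∀ n : ℤ, |(n : ℝ)| ≤ T →
          (if n = 0 then (1 : ℂ) else 0) =
            ∑ c ∈ Finset.Icc 1 ⌊C₀ * Real.sqrt T⌋₊,
              (1 / (c : ℂ)) * ramanujanSum c n * (Δ c (n : ℝ) : ℂ)) := by
  obtain ⟨ψ, hsm, hev, h0, h1, hone, hsupp, M, hM⟩ := exists_psi
  have hMnn : ∀ j, 0 ≤ M j := fun j => (abs_nonneg _).trans (hM j 0)
  have hsupp0 : ∀ x, ψ x ≠ 0 → 1 ≤ |x| ∧ |x| ≤ 2 := fun x hx => hsupp 0 x (by simpa using hx)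
  refine ⟨16, by norm_num, fun j => 1 + 2 ^ j * M j, fun T hT => ?_⟩
  set r := Real.sqrt T with hr
  have hr1 : 1 ≤ r := Real.one_le_sqrt.2 hT
  have hrT : r * r = T := Real.mul_self_sqrt (by linarith)
  have hTr : T ^ (-(1:ℝ)/2) = r⁻¹ := by
    rw [neg_div, Real.rpow_neg (by linarith), hr, Real.sqrt_eq_rpow]
  rw [hTr]
  set m := ⌈r⌉₊ with hm
  have hm1 : r ≤ m := Nat.le_ceil r
  have hm2 : (m:ℝ) ≤ 2 * r := by have := Nat.ceil_lt_add_one (a := r) (by linarith); linarith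
  set Q : ℝ := 4 * m with hQ
  have hQ0 : 0 < Q := by linarith
  set N := ⌊16 * r⌋₊ with hN
  set S := ∑ d ∈ Finset.Icc 1 N, ψ (d / Q) with hS
  have hS2 : 2 * r ≤ S := by
    have hsub : Finset.Icc (5 * m) (7 * m) ⊆ Finset.Icc 1 N := by
      intro d hd
      rw [Finset.mem_Icc] at hd ⊢
      have hmpos : 0 < m := by exact_mod_cast (by linarith : (0:ℝ) < m)
      refine ⟨by omega, hd.2.trans ?_⟩
      apply Nat.le_floor
      push_cast; linarith
    calc 2 * r ≤ ∑ d ∈ Finset.Icc (5 * m) (7 * m), (1:ℝ) := by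
          rw [Finset.sum_const, Nat.card_Icc, nsmul_eq_mul]
          have : 7 * m + 1 - 5 * m = 2 * m + 1 := by omega
          rw [this]; push_cast; linarith
      _ = ∑ d ∈ Finset.Icc (5 * m) (7 * m), ψ (d / Q) := by
          refine Finset.sum_congr rfl fun d hd => ?_
          rw [Finset.mem_Icc] at hd
          have ha : (5 * m : ℝ) ≤ d := by exact_mod_cast hd.1
          have hb : (d : ℝ) ≤ 7 * m := by exact_mod_cast hd.2
          rw [hone]
          · rw [le_div_iff₀ hQ0]; linarith
          · rw [div_le_iff₀ hQ0]; linarith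
      _ ≤ S := Finset.sum_le_sum_of_subset_of_nonneg hsub fun _ _ _ => h0 _
  have hS0 : 0 < S := by linarith
  have hSinv : S⁻¹ * 2 ≤ r⁻¹ := by
    rw [inv_mul_le_iff₀ hS0, ← div_eq_mul_inv, le_div_iff₀ (by linarith)]; exact hS2
  -- the two parts of the function
  let K : ℕ → ℝ := fun c => ∑ d ∈ (Finset.Icc 1 N).filter (c ∣ ·), ((c:ℝ) / d) * ψ (d / Q)
  let G : ℕ → ℝ → ℝ := fun c x =>
    ∑ d ∈ (Finset.Icc 1 N).filter (c ∣ ·), ((c:ℝ) / d) * ψ ((d * Q)⁻¹ * x)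
  have hK : ∀ c, |K c| ≤ 2 := by
    intro c
    have := sum_bound N c Q 1 hQ0 zero_le_one (fun d => ψ (d / Q))
      (fun d _ => by rw [abs_of_nonneg (h0 _)]; exact h1 _) (fun d _ hd => by
        have := hsupp0 _ hd
        rw [abs_of_nonneg (by positivity), le_div_iff₀ hQ0, div_le_iff₀ hQ0] at this
        constructor <;> linarith)
    simpa using this
  have hGs : ∀ c, ContDiff ℝ (⊤ : ℕ∞) (G c) := by
    intro c
    apply ContDiff.sum
    intro d _
    exact contDiff_const.mul (hsm.comp (contDiff_const.mul contDiff_id))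
  have hGd : ∀ c j x, iteratedDeriv j (G c) x = ∑ d ∈ (Finset.Icc 1 N).filter (c ∣ ·),
      ((c:ℝ) / d) * (((d * Q)⁻¹) ^ j * iteratedDeriv j ψ ((d * Q)⁻¹ * x)) := by
    intro c j x
    have hj : ContDiff ℝ j ψ := hsm.of_le (by exact_mod_cast le_top)
    have : ∀ d : ℕ, ContDiff ℝ j (fun x => ψ ((d * Q)⁻¹ * x)) := fun d =>
      hj.comp (contDiff_const.mul contDiff_id)
    change iteratedDeriv j (fun x => ∑ d ∈ (Finset.Icc 1 N).filter (c ∣ ·),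
      ((c:ℝ) / d) * ψ ((d * Q)⁻¹ * x)) x = _
    rw [iteratedDeriv_fun_sum]
    · refine Finset.sum_congr rfl fun d _ => ?_
      rw [iteratedDeriv_const_mul_field, iteratedDeriv_comp_const_mul hj]
    · intro d _
      exact (contDiff_const.mul (this d)).contDiffAt
  have hGb : ∀ c j x, x ≠ 0 → |iteratedDeriv j (G c) x| ≤ 2 * (2 ^ j * M j * (|x| ^ j)⁻¹) := by
    intro c j x hx
    have hx0 : 0 < |x| := abs_pos.2 hx
    rw [hGd]
    have hloc : ∀ d : ℕ, 1 ≤ d → iteratedDeriv j ψ ((d * Q)⁻¹ * x) ≠ 0 →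
        d * Q ≤ |x| ∧ |x| ≤ 2 * (d * Q) := by
      intro d hd h
      have hd0 : (0:ℝ) < d := by exact_mod_cast hd
      have := hsupp _ _ h
      rw [abs_mul, abs_of_pos (by positivity), inv_mul_eq_div, le_div_iff₀ (by positivity),
        div_le_iff₀ (by positivity)] at this
      constructor <;> linarith
    apply sum_bound N c (|x| / (2 * Q)) _ (by positivity)
    · have := hMnn j
      positivity
    · intro d hd
      have hd0 : (0:ℝ) < d := by exact_mod_cast hd
      by_cases h : iteratedDeriv j ψ ((d * Q)⁻¹ * x) = 0
      · rw [h]; simp; have := hMnn j; positivity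
      · obtain ⟨ha, hb⟩ := hloc d hd h
        rw [abs_mul, abs_of_nonneg (by positivity)]
        calc ((d * Q)⁻¹) ^ j * |iteratedDeriv j ψ ((d * Q)⁻¹ * x)|
            ≤ (2 * |x|⁻¹) ^ j * M j := by
              gcongr
              · rw [← div_eq_mul_inv, le_div_iff₀ hx0, inv_mul_le_iff₀ (by positivity)]
                linarith
              · exact hM _ _
          _ = _ := by rw [mul_pow, inv_pow]; ring
    · intro d hd h
      have h' := right_ne_zero_of_mul h
      obtain ⟨ha, hb⟩ := hloc d hd h'
      constructor
      · rw [div_le_iff₀ (by positivity)]; linarith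
      · have : 2 * (|x| / (2 * Q)) = |x| / Q := by field_simp
        rw [this, le_div_iff₀ hQ0]; exact ha
  have hG0 : ∀ c, G c 0 = 0 := by
    intro c
    apply Finset.sum_eq_zero
    intro d _
    have : ψ 0 = 0 := by
      by_contra h
      have := (hsupp0 0 h).1
      norm_num at this
    simp [this]
  refine ⟨fun c x => S⁻¹ * (K c - G c x), ?_, ?_, ?_, ?_, ?_⟩
  · intro c hc x
    have : (Finset.Icc 1 N).filter (c ∣ ·) = ∅ := by
      rw [Finset.filter_eq_empty_iff]
      intro d hd hcd
      rw [Finset.mem_Icc] at hd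
      have h1 := Nat.le_of_dvd (by omega) hcd
      have h2 : N < c := (Nat.floor_lt (by positivity)).2 hc
      omega
    simp [K, G, this]
  · intro c
    exact (contDiff_const.mul (contDiff_const.sub (hGs c))).contDiffOn
  · intro c j x hx hxT
    have hx0 : 0 < |x| := abs_pos.2 hx
    rw [iteratedDeriv_const_mul_field, abs_mul, abs_of_pos (inv_pos.2 hS0),
      Real.rpow_neg hx0.le, Real.rpow_natCast]
    have hmain : |iteratedDeriv j (fun x => K c - G c x) x|
        ≤ 2 * ((1 + 2 ^ j * M j) * (|x| ^ j)⁻¹) := by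
      have hb := hGb c j x hx
      rcases Nat.eq_zero_or_pos j with rfl | hj
      · simp only [iteratedDeriv_zero] at hb ⊢
        have := abs_sub (K c) (G c x)
        have := hK c
        simp at hb ⊢
        linarith
      · rw [iteratedDeriv_const_sub hj, iteratedDeriv_neg, abs_neg]
        have : 0 ≤ (|x| ^ j)⁻¹ := by positivity
        linarith
    have hnn : 0 ≤ (1 + 2 ^ j * M j) * (|x| ^ j)⁻¹ := by have := hMnn j; positivity
    calc S⁻¹ * |iteratedDeriv j (fun x => K c - G c x) x|
        ≤ S⁻¹ * (2 * ((1 + 2 ^ j * M j) * (|x| ^ j)⁻¹)) := by gcongr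
      _ = (S⁻¹ * 2) * ((1 + 2 ^ j * M j) * (|x| ^ j)⁻¹) := by ring
      _ ≤ r⁻¹ * ((1 + 2 ^ j * M j) * (|x| ^ j)⁻¹) := by gcongr
      _ = _ := by ring
  · intro c
    refine ⟨(contDiff_const.mul (contDiff_const.sub (hGs c))).continuous.continuousAt, ?_⟩
    simp only [hG0, sub_zero]
    rw [abs_mul, abs_of_pos (inv_pos.2 hS0)]
    have : S⁻¹ * |K c| ≤ S⁻¹ * 2 := by gcongr; exact hK c
    have : 0 < r⁻¹ := by positivity
    linarith
  · intro n hn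
    let f : ℕ → ℝ := fun d => S⁻¹ * (ψ (d / Q) - ψ ((d * Q)⁻¹ * n))
    have hΔ : ∀ c : ℕ, ((S⁻¹ * (K c - G c n) : ℝ) : ℂ)
        = ∑ d ∈ (Finset.Icc 1 N).filter (c ∣ ·), ((c:ℂ) / d) * (f d : ℂ) := by
      intro c
      simp only [K, G, f]
      rw [← Finset.sum_sub_distrib, Finset.mul_sum]
      push_cast
      refine Finset.sum_congr rfl fun d _ => ?_
      ring
    simp_rw [hΔ]
    rw [sum_swap N n (fun d => (f d : ℂ))]
    by_cases hn0 : n = 0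
    · subst hn0
      have hψ0 : ψ 0 = 0 := by
        by_contra h
        have := (hsupp0 0 h).1
        norm_num at this
      simp only [dvd_zero, if_true]
      rw [← Complex.ofReal_sum]
      have : ∑ d ∈ Finset.Icc 1 N, f d = 1 := by
        simp only [f, Int.cast_zero, mul_zero, hψ0, sub_zero]
        rw [← Finset.mul_sum]
        exact inv_mul_cancel₀ hS0.ne'
      rw [this]; simp
    · rw [if_neg hn0]
      set k := n.natAbs with hk
      have hk0 : k ≠ 0 := Int.natAbs_ne_zero.2 hn0
      have hkn : (k:ℝ) = |(n:ℝ)| := by rw [hk, Nat.cast_natAbs]; push_cast; rfl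
      have hψk : ∀ t : ℝ, ψ (t * n) = ψ (t * k) := by
        intro t
        rw [hkn]
        rcases abs_choice (n:ℝ) with h | h <;> rw [h]
        rw [mul_neg, hev]
      have hbig : ∀ d : ℕ, N < d → f d = 0 := by
        intro d hd
        have hd' : 16 * r < d := (Nat.floor_lt (by positivity)).1 hd
        have ha : ψ (d / Q) = 0 := by
          by_contra h
          have := (hsupp0 _ h).2
          rw [abs_of_nonneg (by positivity), div_le_iff₀ hQ0] at this
          linarith
        have hb : ψ ((d * Q)⁻¹ * n) = 0 := by
          by_contra h
          have := (hsupp0 _ h).1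
          have hd0 : (0:ℝ) < d := by linarith
          rw [abs_mul, abs_of_pos (by positivity), inv_mul_eq_div, le_div_iff₀ (by positivity)]
            at this
          have h3 : d * Q ≤ r * r := by linarith
          nlinarith
        simp only [f, ha, hb, sub_zero, mul_zero]
      have hsum : ∑ d ∈ k.divisors, f d = 0 := by
        simp only [f]
        rw [← Finset.mul_sum, Finset.sum_sub_distrib,
          ← Nat.sum_div_divisors k (fun d => ψ ((d:ℝ) / Q)), ← Finset.sum_sub_distrib,
          Finset.sum_eq_zero, mul_zero]
        intro d hd
        have hdk := Nat.dvd_of_mem_divisors hd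
        have hd0 : (d:ℝ) ≠ 0 := by exact_mod_cast (Nat.pos_of_mem_divisors hd).ne'
        rw [hψk, Nat.cast_div hdk hd0, sub_eq_zero]
        congr 1
        field_simp
      rw [← Finset.sum_filter, ← Complex.ofReal_sum]
      have : ∑ d ∈ (Finset.Icc 1 N).filter (fun d : ℕ => (d:ℤ) ∣ n), f d
          = ∑ d ∈ k.divisors, f d := by
        apply Finset.sum_subset
        · intro d hd
          rw [Finset.mem_filter] at hd
          rw [Nat.mem_divisors]
          exact ⟨Int.natCast_dvd.1 hd.2, hk0⟩
        · intro d hd hnd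
          apply hbig
          by_contra hle
          apply hnd
          rw [Finset.mem_filter, Finset.mem_Icc]
          exact ⟨⟨Nat.pos_of_mem_divisors hd, by omega⟩,
            Int.natCast_dvd.2 (Nat.dvd_of_mem_divisors hd)⟩
      rw [this, hsum]; simp
end

section
/- There is an absolute constant K such that for every nonzero integer a and every real x ≥ 2: (i) | Σ_{m ≤ x, gcd(m, a) = 1} m/φ(m) − x c₀(a) | ≤ K τ(a) log x, and (ii) | Σ_{m ≤ x, gcd(m, a) = 1} 1/φ(m) − ( c₀(a)(log x + γ) + c₀′(a) ) | ≤ K τ(a) x^{−1} log x. -/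
/-- The Euler product `c_s(a) = ∏_{p ∣ a} (1 − p^{−(s+1)}) · ∏_{p ∤ a} (1 + 1/((p−1) p^{s+1}))`. -/
noncomputable def cS (s : ℝ) (a : ℤ) : ℝ :=
  ∏' p : Nat.Primes, if (p : ℤ) ∣ a then 1 - (p : ℝ) ^ (-(s + 1))
    else 1 + 1 / (((p : ℕ) - 1 : ℝ) * (p : ℝ) ^ (s + 1))

/-- `c₀′(a)`, the derivative at `s = 0` of `s ↦ c_s(a)`. -/
noncomputable def cS' (a : ℤ) : ℝ := deriv (fun s : ℝ => cS s a) 0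

noncomputable def tscG (v : ℕ → ℝ) (d : ℕ) : ℝ :=
  if Squarefree d then ∏ p ∈ d.primeFactors, v p else 0

noncomputable def tscV (a : ℤ) (p : ℕ) : ℝ := if (p : ℤ) ∣ a then -1 else 1 / ((p : ℝ) - 1)

noncomputable def tscH (d : ℕ) : ℝ := tscG (fun p => 1 / ((p : ℝ) - 1)) d

lemma tscG_one (v : ℕ → ℝ) : tscG v 1 = 1 := by simp [tscG]

lemma tscG_zero (v : ℕ → ℝ) : tscG v 0 = 0 := by simp [tscG]

lemma tscG_mul (v : ℕ → ℝ) {m n : ℕ} (h : m.Coprime n) : tscG v (m * n) = tscG v m * tscG v n := by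
  unfold tscG
  simp only [Nat.squarefree_mul h]
  by_cases hm : Squarefree m <;> by_cases hn : Squarefree n <;> simp [hm, hn]
  rw [h.primeFactors_mul, Finset.prod_union h.disjoint_primeFactors]

lemma tscG_sum_divisors (v : ℕ → ℝ) {m : ℕ} (hm : m ≠ 0) :
    ∑ d ∈ m.divisors, tscG v d = ∏ p ∈ m.primeFactors, (1 + v p) := by
  unfold tscG
  rw [← Finset.sum_filter, Nat.sum_divisors_filter_squarefree hm, Finset.prod_one_add]
  have : (UniqueFactorizationMonoid.normalizedFactors m).toFinset = m.primeFactors := by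
    rw [Nat.factors_eq]; rfl
  rw [this]
  refine Finset.sum_congr rfl fun t ht => ?_
  rw [Finset.prod_val]
  have ht' := Finset.mem_powerset.mp ht
  have : (t.prod id).primeFactors = t := Nat.primeFactors_prod fun p hp =>
    Nat.prime_of_mem_primeFactors (ht' hp)
  rw [this]

lemma tsc_prime_sub_one_pos {p : ℕ} (hp : p.Prime) : (1 : ℝ) ≤ (p : ℝ) - 1 := by
  have : (2 : ℝ) ≤ p := by exact_mod_cast hp.two_le
  linarith

lemma tsc_div_totient {m : ℕ} (hm : m ≠ 0) :
    (m : ℝ) / (m.totient : ℝ) = ∏ p ∈ m.primeFactors, (1 + 1 / ((p : ℝ) - 1)) := by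
  have h : (m.totient : ℝ) = m * ∏ p ∈ m.primeFactors, (1 - (p : ℝ)⁻¹) := by
    have := Nat.totient_eq_mul_prod_factors m
    have h2 := congrArg (fun q : ℚ => (q : ℝ)) this
    push_cast at h2
    exact h2
  have hm' : (m : ℝ) ≠ 0 := by exact_mod_cast hm
  rw [h, div_mul_eq_div_div, div_self hm', one_div, ← Finset.prod_inv_distrib]
  refine Finset.prod_congr rfl fun p hp => ?_
  have h1 := tsc_prime_sub_one_pos (Nat.prime_of_mem_primeFactors hp)
  have h2 : (p : ℝ) ≠ 0 := by linarith
  have h3 : (p : ℝ) - 1 ≠ 0 := by linarith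
  have h4 : 1 - (p : ℝ)⁻¹ = (p - 1) / p := by field_simp
  rw [h4]
  field_simp
  ring

lemma tscG_conv (a : ℤ) {m : ℕ} (hm : m ≠ 0) :
    ∑ d ∈ m.divisors, tscG (tscV a) d =
      if Int.gcd (m : ℤ) a = 1 then (m : ℝ) / (m.totient : ℝ) else 0 := by
  rw [tscG_sum_divisors _ hm]
  split_ifs with h
  · rw [tsc_div_totient hm]
    refine Finset.prod_congr rfl fun p hp => ?_
    have : ¬ ((p : ℤ) ∣ a) := by
      intro hpa
      have h1 : p ∣ Int.gcd (m : ℤ) a :=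
        Int.dvd_gcd (Int.natCast_dvd_natCast.mpr (Nat.dvd_of_mem_primeFactors hp)) hpa
      rw [h] at h1
      exact (Nat.prime_of_mem_primeFactors hp).one_lt.ne' (Nat.dvd_one.mp h1)
    simp [tscV, this]
  · obtain ⟨p, hp, hpd⟩ := Nat.exists_prime_and_dvd h
    have h1 : (p : ℤ) ∣ m := (Int.natCast_dvd_natCast.mpr hpd).trans (Int.gcd_dvd_left ..)
    have h2 : (p : ℤ) ∣ a := (Int.natCast_dvd_natCast.mpr hpd).trans (Int.gcd_dvd_right ..)
    refine Finset.prod_eq_zero (i := p) ?_ ?_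
    · exact Nat.mem_primeFactors.mpr ⟨hp, Int.natCast_dvd_natCast.mp h1, hm⟩
    · simp [tscV, h2]

lemma tscH_nonneg (d : ℕ) : 0 ≤ tscH d := by
  unfold tscH tscG
  split_ifs
  · refine Finset.prod_nonneg fun p hp => ?_
    have h1 := tsc_prime_sub_one_pos (Nat.prime_of_mem_primeFactors hp)
    exact div_nonneg zero_le_one (by linarith)
  · exact le_rfl

lemma tscH_le (n : ℕ) : tscH n ≤ (1 / n) * ∑ e ∈ n.divisors, tscH e := by
  by_cases hn : n = 0
  · subst hn; simp [tscH, tscG_zero]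
  by_cases hs : Squarefree n
  · refine le_of_eq ?_
    unfold tscH
    rw [tscG_sum_divisors _ hn]
    have : (n : ℝ) = ∏ p ∈ n.primeFactors, (p : ℝ) := by
      conv_lhs => rw [← Nat.prod_primeFactors_of_squarefree hs]
      push_cast; rfl
    rw [this, tscG, if_pos hs, one_div, ← Finset.prod_inv_distrib, ← Finset.prod_mul_distrib]
    refine Finset.prod_congr rfl fun p hp => ?_
    have h1 := tsc_prime_sub_one_pos (Nat.prime_of_mem_primeFactors hp)
    have h2 : (p : ℝ) ≠ 0 := by linarith
    have h3 : (p : ℝ) - 1 ≠ 0 := by linarith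
    field_simp
    ring
  · rw [tscH, tscG, if_neg hs]
    exact mul_nonneg (by positivity) (Finset.sum_nonneg fun e _ => tscH_nonneg e)

lemma tscG_abs_le (a : ℤ) {d : ℕ} (hd : d ≠ 0) :
    |tscG (tscV a) d| ≤ tscH (d / Nat.gcd d a.natAbs) := by
  by_cases hs : Squarefree d
  swap
  · rw [tscG, if_neg hs, abs_zero]; exact tscH_nonneg _
  set c := Nat.gcd d a.natAbs with hc
  have hcd : c ∣ d := Nat.gcd_dvd_left ..
  have he : d = c * (d / c) := (Nat.mul_div_cancel' hcd).symm
  have hcop : c.Coprime (d / c) := by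
    rw [he] at hs
    exact Nat.coprime_of_squarefree_mul hs
  have hsq : Squarefree (d / c) := hs.squarefree_of_dvd (Nat.div_dvd_of_dvd hcd)
  have hsc : Squarefree c := hs.squarefree_of_dvd hcd
  have key : tscG (tscV a) d = tscG (tscV a) c * tscG (tscV a) (d / c) := by
    rw [← tscG_mul _ hcop, ← he]
  have h1 : |tscG (tscV a) c| ≤ 1 := by
    rw [tscG, if_pos hsc, Finset.abs_prod]
    refine Finset.prod_le_one (fun _ _ => abs_nonneg _) fun p hp => ?_
    have : (p : ℤ) ∣ a := by
      rw [Int.natCast_dvd]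
      exact (Nat.dvd_of_mem_primeFactors hp).trans (Nat.gcd_dvd_right ..)
    simp [tscV, this]
  have h2 : tscG (tscV a) (d / c) = tscH (d / c) := by
    rw [tscH, tscG, tscG, if_pos hsq, if_pos hsq]
    refine Finset.prod_congr rfl fun p hp => ?_
    have : ¬ (p : ℤ) ∣ a := by
      intro h
      rw [Int.natCast_dvd] at h
      have hp' := Nat.prime_of_mem_primeFactors hp
      have hpd := Nat.dvd_of_mem_primeFactors hp
      have : p ∣ c := Nat.dvd_gcd (hpd.trans (Nat.div_dvd_of_dvd hcd)) h
      exact hp'.one_lt.ne' (Nat.dvd_one.mp (hcop ▸ Nat.dvd_gcd this hpd))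
    simp [tscV, this]
  rw [key, abs_mul, h2, abs_of_nonneg (tscH_nonneg _)]
  exact mul_le_of_le_one_left (tscH_nonneg _) h1

lemma tsc_swap (N : ℕ) (f : ℕ → ℕ → ℝ) :
    ∑ m ∈ Finset.Icc 1 N, ∑ d ∈ m.divisors, f d (m / d) =
      ∑ d ∈ Finset.Icc 1 N, ∑ k ∈ Finset.Icc 1 (N / d), f d k := by
  rw [Finset.sum_sigma', Finset.sum_sigma']
  refine Finset.sum_bij' (fun x _ => ⟨x.2, x.1 / x.2⟩) (fun x _ => ⟨x.1 * x.2, x.1⟩) ?_ ?_ ?_ ?_ ?_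
  · rintro ⟨m, d⟩ h
    simp only [Finset.mem_sigma, Finset.mem_Icc, Nat.mem_divisors] at h ⊢
    obtain ⟨⟨h1, h2⟩, h3, h4⟩ := h
    have hd := Nat.pos_of_dvd_of_pos h3 h1
    exact ⟨⟨hd, (Nat.le_of_dvd h1 h3).trans h2⟩, Nat.div_pos (Nat.le_of_dvd h1 h3) hd,
      Nat.div_le_div_right h2⟩
  · rintro ⟨d, k⟩ h
    simp only [Finset.mem_sigma, Finset.mem_Icc, Nat.mem_divisors] at h ⊢
    obtain ⟨⟨h1, h2⟩, h3, h4⟩ := h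
    have := (Nat.le_div_iff_mul_le h1).mp h4
    refine ⟨⟨Nat.mul_pos h1 h3, by rwa [mul_comm]⟩, dvd_mul_right _ _, (Nat.mul_pos h1 h3).ne'⟩
  · rintro ⟨m, d⟩ h
    simp only [Finset.mem_sigma, Finset.mem_Icc, Nat.mem_divisors] at h ⊢
    simp [Nat.mul_div_cancel' h.2.1]
  · rintro ⟨d, k⟩ h
    simp only [Finset.mem_sigma, Finset.mem_Icc, Nat.mem_divisors] at h ⊢
    simp [Nat.mul_div_cancel_left k h.1.1]
  · rintro ⟨m, d⟩ h
    rfl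

lemma tsc_W1 (a : ℤ) (ha : a ≠ 0) (M : ℕ) (w : ℕ → ℝ) (hw : ∀ n, 0 ≤ w n) :
    ∑ d ∈ Finset.Icc 1 M, |tscG (tscV a) d| * w d ≤
      ∑ c ∈ a.natAbs.divisors, ∑ n ∈ Finset.Icc 1 M, tscH n * w (c * n) := by
  have hnn : ∀ c n d : ℕ, 0 ≤ if c * n = d then tscH n * w (c * n) else 0 := by
    intro c n d
    split_ifs
    · exact mul_nonneg (tscH_nonneg _) (hw _)
    · exact le_rfl
  calc ∑ d ∈ Finset.Icc 1 M, |tscG (tscV a) d| * w d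
      ≤ ∑ d ∈ Finset.Icc 1 M, ∑ c ∈ a.natAbs.divisors, ∑ n ∈ Finset.Icc 1 M,
          if c * n = d then tscH n * w (c * n) else 0 := by
        refine Finset.sum_le_sum fun d hd => ?_
        rw [Finset.mem_Icc] at hd
        have hg : Nat.gcd d a.natAbs ∣ d := Nat.gcd_dvd_left ..
        have hgpos : 0 < Nat.gcd d a.natAbs := Nat.gcd_pos_of_pos_left _ hd.1
        have hmem : Nat.gcd d a.natAbs ∈ a.natAbs.divisors :=
          Nat.mem_divisors.mpr ⟨Nat.gcd_dvd_right .., Int.natAbs_ne_zero.mpr ha⟩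
        have hmem2 : d / Nat.gcd d a.natAbs ∈ Finset.Icc 1 M := by
          rw [Finset.mem_Icc]
          exact ⟨Nat.div_pos (Nat.le_of_dvd hd.1 hg) hgpos, (Nat.div_le_self _ _).trans hd.2⟩
        refine le_trans ?_ (Finset.single_le_sum
          (fun c _ => Finset.sum_nonneg fun n _ => hnn c n d) hmem)
        refine le_trans ?_ (Finset.single_le_sum (fun n _ => hnn _ n d) hmem2)
        rw [Nat.mul_div_cancel' hg, if_pos rfl]
        exact mul_le_mul_of_nonneg_right (tscG_abs_le a (by lia)) (hw _)
    _ = ∑ c ∈ a.natAbs.divisors, ∑ n ∈ Finset.Icc 1 M, ∑ d ∈ Finset.Icc 1 M,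
          if c * n = d then tscH n * w (c * n) else 0 := by
        rw [Finset.sum_comm]
        refine Finset.sum_congr rfl fun c _ => ?_
        rw [Finset.sum_comm]
    _ ≤ _ := by
        refine Finset.sum_le_sum fun c _ => Finset.sum_le_sum fun n _ => ?_
        rw [Finset.sum_ite_eq]
        split_ifs
        · exact le_rfl
        · exact mul_nonneg (tscH_nonneg _) (hw _)

lemma tsc_W2 (M : ℕ) (w : ℕ → ℝ) (hw : ∀ n, 0 ≤ w n) :
    ∑ n ∈ Finset.Icc 1 M, tscH n * w n ≤
      ∑ e ∈ Finset.Icc 1 M, tscH e / e * ∑ k ∈ Finset.Icc 1 M, w (e * k) / k := by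
  calc ∑ n ∈ Finset.Icc 1 M, tscH n * w n
      ≤ ∑ n ∈ Finset.Icc 1 M, ∑ e ∈ n.divisors, (tscH e / e) * (w (e * (n / e)) / ((n / e : ℕ) : ℝ)) := by
        refine Finset.sum_le_sum fun n hn => ?_
        refine (mul_le_mul_of_nonneg_right (tscH_le n) (hw n)).trans (le_of_eq ?_)
        rw [mul_right_comm, Finset.mul_sum]
        refine Finset.sum_congr rfl fun e he => ?_
        have hen := Nat.dvd_of_mem_divisors he
        have : (n : ℝ) = e * ((n / e : ℕ) : ℝ) := by
          rw [← Nat.cast_mul, Nat.mul_div_cancel' hen]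
        rw [Nat.mul_div_cancel' hen, this]
        field_simp
    _ = ∑ e ∈ Finset.Icc 1 M, ∑ k ∈ Finset.Icc 1 (M / e), (tscH e / e) * (w (e * k) / (k : ℝ)) :=
        tsc_swap M (fun e k => (tscH e / e) * (w (e * k) / (k : ℝ)))
    _ ≤ _ := by
        refine Finset.sum_le_sum fun e _ => ?_
        rw [Finset.mul_sum]
        refine Finset.sum_le_sum_of_subset_of_nonneg
          (Finset.Icc_subset_Icc_right (Nat.div_le_self _ _)) fun k _ _ => ?_
        exact mul_nonneg (div_nonneg (tscH_nonneg _) (Nat.cast_nonneg _))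
          (div_nonneg (hw _) (Nat.cast_nonneg _))

lemma tscH_le_sqrt (n : ℕ) : tscH n * √n ≤ 2 := by
  by_cases hs : Squarefree n
  swap
  · rw [tscH, tscG, if_neg hs]; norm_num
  have hn : √(n : ℝ) = ∏ p ∈ n.primeFactors, √(p : ℝ) := by
    conv_lhs => rw [← Nat.prod_primeFactors_of_squarefree hs]
    push_cast
    rw [Real.sqrt_eq_rpow, ← Real.finsetProd_rpow _ _ (fun i _ => Nat.cast_nonneg i)]
    simp [Real.sqrt_eq_rpow]
  rw [hn, tscH, tscG, if_pos hs, ← Finset.prod_mul_distrib]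
  have hle : ∀ p ∈ n.primeFactors, 1 / ((p : ℝ) - 1) * √(p : ℝ) ≤ if 2 = p then (2 : ℝ) else 1 := by
    intro p hp
    have h1 := tsc_prime_sub_one_pos (Nat.prime_of_mem_primeFactors hp)
    split_ifs with h
    · subst h
      have : √(2 : ℝ) ≤ 2 := by
        rw [Real.sqrt_le_left (by norm_num)]; norm_num
      norm_num
    · have h3 : 3 ≤ p := by
        have := (Nat.prime_of_mem_primeFactors hp).two_le
        lia
      have h3' : (3 : ℝ) ≤ p := by exact_mod_cast h3
      have : √(p : ℝ) ≤ (p : ℝ) - 1 := by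
        rw [Real.sqrt_le_left (by linarith)]
        nlinarith
      rw [one_div, inv_mul_le_iff₀ (by linarith)]
      linarith
  refine (Finset.prod_le_prod (fun p hp => ?_) hle).trans ?_
  · have h1 := tsc_prime_sub_one_pos (Nat.prime_of_mem_primeFactors hp)
    have : 0 ≤ (p : ℝ) - 1 := by linarith
    positivity
  · rw [Finset.prod_ite_eq]
    split_ifs <;> norm_num

lemma tscG_crude (a : ℤ) (ha : a ≠ 0) (d : ℕ) :
    |tscG (tscV a) d| ≤ 2 * √(a.natAbs : ℝ) * (d : ℝ) ^ (-(1 / 2) : ℝ) := by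
  by_cases hd : d = 0
  · subst hd
    rw [tscG_zero, abs_zero]; positivity
  have hdpos : (0 : ℝ) < d := by exact_mod_cast Nat.pos_of_ne_zero hd
  refine (tscG_abs_le a hd).trans ?_
  set c := Nat.gcd d a.natAbs with hc
  have hcd : c ∣ d := Nat.gcd_dvd_left ..
  have hcpos : 0 < c := Nat.gcd_pos_of_pos_left _ (Nat.pos_of_ne_zero hd)
  have hca : (c : ℝ) ≤ a.natAbs := by
    exact_mod_cast Nat.le_of_dvd (Int.natAbs_pos.mpr ha) (Nat.gcd_dvd_right ..)
  have h := tscH_le_sqrt (d / c)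
  have hdd : (d : ℝ) = c * ((d / c : ℕ) : ℝ) := by
    rw [← Nat.cast_mul, Nat.mul_div_cancel' hcd]
  rw [Real.rpow_neg hdpos.le, ← Real.sqrt_eq_rpow, ← div_eq_mul_inv,
    le_div_iff₀ (Real.sqrt_pos.mpr hdpos)]
  calc tscH (d / c) * √(d : ℝ) = √(c : ℝ) * (tscH (d / c) * √((d / c : ℕ) : ℝ)) := by
        conv_lhs => rw [hdd, Real.sqrt_mul (Nat.cast_nonneg _)]
        ring
    _ ≤ √(a.natAbs : ℝ) * 2 := by
        refine mul_le_mul (Real.sqrt_le_sqrt hca) h ?_ (Real.sqrt_nonneg _)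
        exact mul_nonneg (tscH_nonneg _) (Real.sqrt_nonneg _)
    _ = _ := by ring

lemma tscH_summable : Summable (fun e : ℕ => tscH e / e) := by
  have h : Summable (fun e : ℕ => 2 * (e : ℝ) ^ (-(3 / 2) : ℝ)) :=
    (Real.summable_nat_rpow.mpr (by norm_num)).mul_left 2
  refine Summable.of_nonneg_of_le (fun e => div_nonneg (tscH_nonneg e) (Nat.cast_nonneg e)) ?_ h
  intro e
  by_cases he : e = 0
  · subst he; simp
  have hpos : (0 : ℝ) < e := by exact_mod_cast Nat.pos_of_ne_zero he
  have h1 := tscH_le_sqrt e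
  have h2 : (e : ℝ) ^ (-(3 / 2) : ℝ) = (√(e : ℝ))⁻¹ * (e : ℝ)⁻¹ := by
    rw [Real.sqrt_eq_rpow, ← Real.rpow_neg hpos.le, ← Real.rpow_neg_one, ← Real.rpow_add hpos]
    norm_num
  rw [h2, ← mul_assoc, div_eq_mul_inv]
  refine mul_le_mul_of_nonneg_right ?_ (by positivity)
  rwa [← div_eq_mul_inv, le_div_iff₀ (Real.sqrt_pos.mpr hpos)]

noncomputable def tscC : ℝ := ∑' e : ℕ, tscH e / e

lemma tscC_nonneg : 0 ≤ tscC :=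
  tsum_nonneg fun e => div_nonneg (tscH_nonneg e) (Nat.cast_nonneg e)

lemma tsc_W3 (M : ℕ) (w : ℕ → ℝ) (hw : ∀ n, 0 ≤ w n) (B : ℝ) (hB : 0 ≤ B)
    (h : ∀ e, 1 ≤ e → ∑ k ∈ Finset.Icc 1 M, w (e * k) / k ≤ B) :
    ∑ n ∈ Finset.Icc 1 M, tscH n * w n ≤ tscC * B := by
  refine (tsc_W2 M w hw).trans ?_
  calc _ ≤ ∑ e ∈ Finset.Icc 1 M, tscH e / e * B := by
        refine Finset.sum_le_sum fun e he => ?_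
        exact mul_le_mul_of_nonneg_left (h e (Finset.mem_Icc.mp he).1)
          (div_nonneg (tscH_nonneg e) (Nat.cast_nonneg e))
    _ = (∑ e ∈ Finset.Icc 1 M, tscH e / e) * B := by rw [Finset.sum_mul]
    _ ≤ tscC * B := by
        refine mul_le_mul_of_nonneg_right ?_ hB
        exact tscH_summable.sum_le_tsum _
          fun e _ => div_nonneg (tscH_nonneg e) (Nat.cast_nonneg e)

lemma tsc_W4 (a : ℤ) (ha : a ≠ 0) (M : ℕ) (w : ℕ → ℝ) (hw : ∀ n, 0 ≤ w n) (B : ℝ) (hB : 0 ≤ B)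
    (h : ∀ e, 1 ≤ e → ∑ k ∈ Finset.Icc 1 M, w (e * k) / k ≤ B) :
    ∑ d ∈ Finset.Icc 1 M, |tscG (tscV a) d| * w d ≤ a.natAbs.divisors.card * (tscC * B) := by
  refine (tsc_W1 a ha M w hw).trans ?_
  rw [← nsmul_eq_mul]
  refine Finset.sum_le_card_nsmul _ _ _ fun c hc => ?_
  refine tsc_W3 M (fun n => w (c * n)) (fun n => hw _) B hB fun e he => ?_
  have := h (c * e) (Nat.mul_pos (Nat.pos_of_mem_divisors hc) he)
  simpa [mul_assoc] using this

lemma tsc_harm (n : ℕ) : ∑ k ∈ Finset.Icc 1 n, (1 : ℝ) / k = (harmonic n : ℝ) := by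
  rw [harmonic_eq_sum_Icc]
  push_cast
  simp

lemma tsc_L1 (a : ℤ) (ha : a ≠ 0) (N : ℕ) :
    ∑ d ∈ Finset.Icc 1 N, |tscG (tscV a) d| ≤
      a.natAbs.divisors.card * (tscC * (1 + Real.log N)) := by
  have := tsc_W4 a ha N (fun _ => 1) (fun _ => zero_le_one) (1 + Real.log N)
    (add_nonneg zero_le_one (Real.log_natCast_nonneg N)) (fun e _ => by
      rw [tsc_harm]; exact harmonic_le_one_add_log N)
  simpa using this

lemma tsc_tele {k : ℕ} (hk : 1 ≤ k) :
    (√(k : ℝ))⁻¹ / k ≤ 4 * ((√(k : ℝ))⁻¹ - (√((k + 1 : ℕ) : ℝ))⁻¹) := by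
  have hk' : (1 : ℝ) ≤ k := by exact_mod_cast hk
  set s := √(k : ℝ) with hs
  set t := √((k + 1 : ℕ) : ℝ) with ht
  have hs1 : s ^ 2 = k := Real.sq_sqrt (by linarith)
  have ht1 : t ^ 2 = k + 1 := by rw [ht, Real.sq_sqrt (by positivity)]; push_cast; rfl
  have hs0 : 0 < s := Real.sqrt_pos.mpr (by linarith)
  have ht0 : 0 < t := Real.sqrt_pos.mpr (by positivity)
  have hst : s ≤ t := Real.sqrt_le_sqrt (by push_cast; linarith)
  have ht2 : t ≤ 3 / 2 * s := by
    refine abs_le_of_sq_le_sq' ?_ (by positivity) |>.2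
    nlinarith
  have e1 : s⁻¹ - t⁻¹ = 1 / (s * t * (s + t)) := by
    field_simp
    nlinarith
  rw [e1, ← hs1]
  have e2 : s⁻¹ / s ^ 2 = 1 / s ^ 3 := by field_simp
  rw [e2, mul_one_div, div_le_div_iff₀ (by positivity) (by positivity)]
  have : s * t * (s + t) ≤ s * (3 / 2 * s) * (s + 3 / 2 * s) := by gcongr
  nlinarith [pow_pos hs0 3]

lemma tsc_tail (y : ℝ) (hy : 0 < y) (M : ℕ) :
    ∑ k ∈ Finset.Icc 1 M, (if y < (k : ℝ) then (√(k : ℝ))⁻¹ / k else 0) ≤ 4 * (√y)⁻¹ := by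
  rw [← Finset.sum_filter]
  have hsub : (Finset.Icc 1 M).filter (fun k : ℕ => y < (k : ℝ)) ⊆
      Finset.Ico (⌊y⌋₊ + 1) (⌊y⌋₊ + 1 + M) := by
    intro k hk
    simp only [Finset.mem_filter, Finset.mem_Icc] at hk
    rw [Finset.mem_Ico]
    have : ⌊y⌋₊ < k := (Nat.floor_lt hy.le).mpr hk.2
    lia
  refine (Finset.sum_le_sum_of_subset_of_nonneg hsub fun k _ _ => by positivity).trans ?_
  have h1 : ∑ k ∈ Finset.Ico (⌊y⌋₊ + 1) (⌊y⌋₊ + 1 + M), (√(k : ℝ))⁻¹ / k ≤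
      ∑ k ∈ Finset.Ico (⌊y⌋₊ + 1) (⌊y⌋₊ + 1 + M),
        4 * ((√(k : ℝ))⁻¹ - (√((k + 1 : ℕ) : ℝ))⁻¹) := by
    refine Finset.sum_le_sum fun k hk => tsc_tele ?_
    rw [Finset.mem_Ico] at hk
    lia
  refine h1.trans ?_
  rw [← Finset.mul_sum]
  have h2 : ∑ k ∈ Finset.Ico (⌊y⌋₊ + 1) (⌊y⌋₊ + 1 + M),
      ((√(k : ℝ))⁻¹ - (√((k + 1 : ℕ) : ℝ))⁻¹) =
      (√((⌊y⌋₊ + 1 : ℕ) : ℝ))⁻¹ - (√((⌊y⌋₊ + 1 + M : ℕ) : ℝ))⁻¹ := by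
    have := Finset.sum_Ico_sub (fun k : ℕ => (√(k : ℝ))⁻¹)
      (show ⌊y⌋₊ + 1 ≤ ⌊y⌋₊ + 1 + M by lia)
    rw [← neg_inj, ← Finset.sum_neg_distrib]
    simpa using this
  rw [h2]
  have h3 : (√((⌊y⌋₊ + 1 : ℕ) : ℝ))⁻¹ ≤ (√y)⁻¹ := by
    refine inv_anti₀ (Real.sqrt_pos.mpr hy) (Real.sqrt_le_sqrt ?_)
    push_cast
    exact (Nat.lt_floor_add_one y).le
  have h4 : 0 ≤ (√((⌊y⌋₊ + 1 + M : ℕ) : ℝ))⁻¹ := by positivity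
  linarith

lemma tsc_L2 (a : ℤ) (ha : a ≠ 0) (x : ℝ) (hx : 0 < x) (M : ℕ) :
    ∑ d ∈ Finset.Icc 1 M, |tscG (tscV a) d| * (if x < (d : ℝ) then (√(d : ℝ))⁻¹ else 0) ≤
      a.natAbs.divisors.card * (tscC * (4 * (√x)⁻¹)) := by
  refine tsc_W4 a ha M (fun d => if x < (d : ℝ) then (√(d : ℝ))⁻¹ else 0) (fun d => ?_)
    _ (by positivity) fun e he => ?_
  · split_ifs <;> positivity
  · have he' : (0 : ℝ) < e := by exact_mod_cast he
    have h := mul_le_mul_of_nonneg_left (tsc_tail (x / e) (by positivity) M)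
      (show 0 ≤ (√(e : ℝ))⁻¹ by positivity)
    have e1 : (√(e : ℝ))⁻¹ * (4 * (√(x / e))⁻¹) = 4 * (√x)⁻¹ := by
      rw [Real.sqrt_div hx.le]
      have : √(e : ℝ) ≠ 0 := (Real.sqrt_pos.mpr he').ne'
      field_simp
    rw [e1] at h
    refine le_trans (le_of_eq ?_) h
    rw [Finset.mul_sum]
    refine Finset.sum_congr rfl fun k _ => ?_
    have : x / e < (k : ℝ) ↔ x < ((e * k : ℕ) : ℝ) := by
      rw [div_lt_iff₀ he', mul_comm]; push_cast; rfl
    simp only [this]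
    split_ifs
    · push_cast
      rw [Real.sqrt_mul he'.le, mul_inv]
      ring
    · simp

lemma tsc_summable_aux (a : ℤ) (ha : a ≠ 0) (r : ℝ) (hr : r < -(1 / 2)) :
    Summable (fun d : ℕ => |tscG (tscV a) d| * (d : ℝ) ^ r) := by
  have h : Summable (fun d : ℕ => 2 * √(a.natAbs : ℝ) * (d : ℝ) ^ (r - 1 / 2)) :=
    (Real.summable_nat_rpow.mpr (by linarith)).mul_left _
  refine Summable.of_nonneg_of_le (fun d => by positivity) (fun d => ?_) h
  by_cases hd : d = 0
  · subst hd
    rw [tscG_zero, abs_zero, zero_mul]; positivity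
  have hpos : (0 : ℝ) < d := by exact_mod_cast Nat.pos_of_ne_zero hd
  refine (mul_le_mul_of_nonneg_right (tscG_crude a ha d) (by positivity)).trans (le_of_eq ?_)
  rw [mul_assoc, ← Real.rpow_add hpos]
  congr 2
  ring

lemma tsc_cS_eq (a : ℤ) (ha : a ≠ 0) (s : ℝ) (hs : -(1 / 2) < s) :
    cS s a = ∑' d : ℕ, tscG (tscV a) d * (d : ℝ) ^ (-(s + 1)) := by
  have hsum : Summable (fun d : ℕ => ‖tscG (tscV a) d * (d : ℝ) ^ (-(s + 1))‖) := by
    refine (tsc_summable_aux a ha (-(s + 1)) (by linarith)).congr fun d => ?_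
    rw [norm_mul, Real.norm_eq_abs, Real.norm_eq_abs,
      abs_of_nonneg (Real.rpow_nonneg (Nat.cast_nonneg d) _)]
  have key := EulerProduct.eulerProduct_hasProd
    (f := fun d : ℕ => tscG (tscV a) d * (d : ℝ) ^ (-(s + 1)))
    (by simp [tscG_one])
    (by
      intro m n hmn
      rw [tscG_mul _ hmn, Nat.cast_mul, Real.mul_rpow (Nat.cast_nonneg _) (Nat.cast_nonneg _)]
      ring)
    hsum (by simp [tscG_zero])
  rw [← key.tprod_eq, cS]
  congr 1
  funext p
  have hp := p.prop
  have h1 := tsc_prime_sub_one_pos hp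
  have hp0 : (0 : ℝ) < (p : ℕ) := by linarith
  rw [tsum_eq_sum (s := Finset.range 2)]
  · rw [Finset.sum_range_succ, Finset.sum_range_one, pow_zero, pow_one, tscG_one]
    have : tscG (tscV a) p = tscV a p := by
      rw [tscG, if_pos hp.prime.squarefree, hp.primeFactors, Finset.prod_singleton]
    rw [this, tscV]
    split_ifs
    · simp; ring
    · rw [Real.rpow_neg hp0.le]
      simp [mul_comm]
  · intro e he
    have he2 : 2 ≤ e := by
      rw [Finset.mem_range] at he
      lia
    have : ¬ Squarefree ((p : ℕ) ^ e) := by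
      intro h
      have := (Nat.squarefree_pow_iff hp.one_lt.ne' (by lia)).mp h
      lia
    rw [tscG, if_neg this, zero_mul]

lemma tsc_summable0 (a : ℤ) (ha : a ≠ 0) (s : ℝ) (hs : -(1 / 2) < s) :
    Summable (fun d : ℕ => tscG (tscV a) d * (d : ℝ) ^ (-(s + 1))) := by
  refine Summable.of_norm ?_
  refine (tsc_summable_aux a ha (-(s + 1)) (by linarith)).congr fun d => ?_
  rw [norm_mul, Real.norm_eq_abs, Real.norm_eq_abs,
      abs_of_nonneg (Real.rpow_nonneg (Nat.cast_nonneg d) _)]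

lemma tsc_hasSum (a : ℤ) (ha : a ≠ 0) :
    HasSum (fun d : ℕ => tscG (tscV a) d / d) (cS 0 a) := by
  have h := (tsc_summable0 a ha 0 (by norm_num)).hasSum
  rw [← tsc_cS_eq a ha 0 (by norm_num)] at h
  convert h using 2 with d
  rw [zero_add, Real.rpow_neg_one, div_eq_mul_inv]

lemma tsc_deriv_bound (a : ℤ) (y : ℝ) (hy : -(1 / 4) < y) (d : ℕ) :
    ‖tscG (tscV a) d * ((d : ℝ) ^ (-(y + 1)) * Real.log d * (-1))‖ ≤
      8 * (|tscG (tscV a) d| * (d : ℝ) ^ (-(5 / 8) : ℝ)) := by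
  by_cases hd : d = 0
  · subst hd; simp [tscG_zero]
  have hd1 : (1 : ℝ) ≤ d := by exact_mod_cast Nat.pos_of_ne_zero hd
  have hpos : (0 : ℝ) < d := by linarith
  have hl := Real.log_nonneg hd1
  rw [norm_mul, norm_mul, norm_mul, Real.norm_eq_abs, Real.norm_eq_abs, Real.norm_eq_abs,
    abs_of_nonneg (Real.rpow_nonneg hpos.le _), abs_of_nonneg hl]
  simp only [norm_neg, norm_one, mul_one]
  have h1 : Real.log d ≤ 8 * (d : ℝ) ^ (1 / 8 : ℝ) := by
    have := Real.log_le_rpow_div hpos.le (show (0 : ℝ) < 1 / 8 by norm_num)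
    linarith
  have h2 : (d : ℝ) ^ (-(y + 1)) ≤ (d : ℝ) ^ (-(3 / 4) : ℝ) :=
    Real.rpow_le_rpow_of_exponent_le hd1 (by linarith)
  calc |tscG (tscV a) d| * ((d : ℝ) ^ (-(y + 1)) * Real.log d)
      ≤ |tscG (tscV a) d| * ((d : ℝ) ^ (-(3 / 4) : ℝ) * (8 * (d : ℝ) ^ (1 / 8 : ℝ))) := by gcongr
    _ = 8 * (|tscG (tscV a) d| * ((d : ℝ) ^ (-(3 / 4) : ℝ) * (d : ℝ) ^ (1 / 8 : ℝ))) := by ring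
    _ = _ := by
        rw [← Real.rpow_add hpos]
        norm_num

lemma tsc_hasSum' (a : ℤ) (ha : a ≠ 0) :
    HasSum (fun d : ℕ => tscG (tscV a) d * Real.log d / d) (-cS' a) := by
  have hu : Summable (fun d : ℕ => 8 * (|tscG (tscV a) d| * (d : ℝ) ^ (-(5 / 8) : ℝ))) :=
    (tsc_summable_aux a ha _ (by norm_num)).mul_left 8
  have hmem : (0 : ℝ) ∈ Set.Ioo (-(1 / 4) : ℝ) (1 / 4) := by constructor <;> norm_num
  have hder := hasDerivAt_tsum_of_isPreconnected (t := Set.Ioo (-(1 / 4) : ℝ) (1 / 4))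
    (g := fun (d : ℕ) (s : ℝ) => tscG (tscV a) d * (d : ℝ) ^ (-(s + 1)))
    (g' := fun (d : ℕ) (s : ℝ) => tscG (tscV a) d * ((d : ℝ) ^ (-(s + 1)) * Real.log d * (-1)))
    (y₀ := 0) (y := 0) hu isOpen_Ioo isPreconnected_Ioo
    (by
      intro d y _
      by_cases hd : d = 0
      · subst hd
        simp only [tscG_zero, zero_mul]
        exact hasDerivAt_const _ _
      have hpos : (0 : ℝ) < d := by exact_mod_cast Nat.pos_of_ne_zero hd
      refine HasDerivAt.const_mul _ ?_
      have h1 : HasDerivAt (fun s : ℝ => -(s + 1)) (-1) y := ((hasDerivAt_id y).add_const 1).neg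
      have h2 := h1.const_rpow hpos
      exact h2.congr_deriv (by ring))
    (fun d y hy => tsc_deriv_bound a y hy.1 d) hmem
    (tsc_summable0 a ha 0 (by norm_num)) hmem
  have heq : (fun s : ℝ => cS s a) =ᶠ[nhds 0]
      fun s => ∑' d : ℕ, tscG (tscV a) d * (d : ℝ) ^ (-(s + 1)) := by
    filter_upwards [isOpen_Ioo.mem_nhds hmem] with s hs
    exact tsc_cS_eq a ha s (by linarith [hs.1])
  have hd2 := (hder.congr_of_eventuallyEq heq).deriv
  have hsm : Summable (fun d : ℕ =>
      tscG (tscV a) d * ((d : ℝ) ^ (-((0 : ℝ) + 1)) * Real.log d * (-1))) :=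
    Summable.of_norm_bounded hu fun d => tsc_deriv_bound a 0 (by norm_num) d
  have h := hsm.hasSum
  rw [← hd2] at h
  have h' := h.neg
  rw [cS']
  have e : (fun d : ℕ => tscG (tscV a) d * Real.log d / d) = fun d : ℕ =>
      -(tscG (tscV a) d * ((d : ℝ) ^ (-((0 : ℝ) + 1)) * Real.log d * (-1))) := by
    funext d
    rw [zero_add, Real.rpow_neg_one]
    ring
  rw [e]
  exact h'

lemma tsc_tendsto {f : ℕ → ℝ} {S : ℝ} (h : HasSum f S) (h0 : f 0 = 0) :
    Filter.Tendsto (fun M : ℕ => ∑ d ∈ Finset.Icc 1 M, f d) Filter.atTop (nhds S) := by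
  have h1 := h.tendsto_sum_nat.comp (Filter.tendsto_add_atTop_nat 1)
  refine h1.congr fun M => ?_
  symm
  refine Finset.sum_subset (fun d hd => ?_) fun d hd hd' => ?_
  · simp only [Finset.mem_Icc, Finset.mem_range] at *; lia
  · have : d = 0 := by
      simp only [Finset.mem_Icc, Finset.mem_range] at *; lia
    rw [this, h0]

lemma tsc_harm_log (y : ℝ) (hy : 1 ≤ y) :
    |(harmonic ⌊y⌋₊ : ℝ) - (Real.log y + Real.eulerMascheroniConstant)| ≤ 2 / y := by
  set n := ⌊y⌋₊ with hn
  have hn1 : 1 ≤ n := Nat.one_le_floor_iff y |>.mpr hy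
  have hn1' : (1 : ℝ) ≤ n := by exact_mod_cast hn1
  have h1 := Real.eulerMascheroniSeq_lt_eulerMascheroniConstant n
  have h2 := Real.eulerMascheroniConstant_lt_eulerMascheroniSeq' n
  rw [Real.eulerMascheroniSeq] at h1
  rw [Real.eulerMascheroniSeq', if_neg (by lia)] at h2
  have h3 : Real.log n ≤ Real.log y :=
    Real.log_le_log (by linarith) (Nat.floor_le (by linarith))
  have h4 : Real.log y ≤ Real.log (n + 1) :=
    Real.log_le_log (by linarith) (Nat.lt_floor_add_one y).le
  have h5 : Real.log (n + 1) - Real.log n ≤ 1 / n := by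
    rw [← Real.log_div (by linarith) (by linarith)]
    refine (Real.log_le_sub_one_of_pos (by positivity)).trans (le_of_eq ?_)
    field_simp
    ring
  have h6 : (1 : ℝ) / n ≤ 2 / y := by
    rw [div_le_div_iff₀ (by linarith) (by linarith)]
    have := Nat.lt_floor_add_one y
    linarith
  rw [abs_le]
  constructor <;> linarith

lemma tsc_split (N M : ℕ) (hNM : N ≤ M) (f : ℕ → ℝ) :
    ∑ d ∈ Finset.Icc 1 M, f d =
      ∑ d ∈ Finset.Icc 1 N, f d + ∑ d ∈ Finset.Ioc N M, f d := by
  rw [← Finset.sum_union]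
  · congr 1
    ext d
    simp only [Finset.mem_union, Finset.mem_Icc, Finset.mem_Ioc]
    lia
  · rw [Finset.disjoint_left]
    intro d
    simp only [Finset.mem_Icc, Finset.mem_Ioc]
    lia

/-- weighted tail -/
lemma tsc_L3 (a : ℤ) (ha : a ≠ 0) (x : ℝ) (hx : 2 ≤ x) (M : ℕ) :
    ∑ d ∈ Finset.Ioc ⌊x⌋₊ M, |tscG (tscV a) d| / d * (1 + Real.log (d / x)) ≤
      a.natAbs.divisors.card * (tscC * 8) * x⁻¹ := by
  have hx0 : 0 < x := by linarith
  have hsx : 0 < √x := Real.sqrt_pos.mpr hx0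
  have h := mul_le_mul_of_nonneg_left (tsc_L2 a ha x hx0 M) (show 0 ≤ 2 * (√x)⁻¹ by positivity)
  have e1 : 2 * (√x)⁻¹ * (a.natAbs.divisors.card * (tscC * (4 * (√x)⁻¹))) =
      a.natAbs.divisors.card * (tscC * 8) * x⁻¹ := by
    have : x⁻¹ = (√x)⁻¹ * (√x)⁻¹ := by rw [← mul_inv, Real.mul_self_sqrt hx0.le]
    rw [this]; ring
  rw [e1] at h
  refine le_trans ?_ h
  rw [Finset.mul_sum]
  have hsub : Finset.Ioc ⌊x⌋₊ M ⊆ Finset.Icc 1 M := by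
    intro d
    simp only [Finset.mem_Icc, Finset.mem_Ioc]
    lia
  refine le_trans ?_ (Finset.sum_le_sum_of_subset_of_nonneg hsub fun d _ _ => ?_)
  · refine Finset.sum_le_sum fun d hd => ?_
    have hxd : x < d := (Nat.floor_lt hx0.le).mp (Finset.mem_Ioc.mp hd).1
    have hd0 : (0 : ℝ) < d := by linarith
    have hsd : 0 < √(d : ℝ) := Real.sqrt_pos.mpr hd0
    rw [if_pos hxd]
    have hlog : 1 + Real.log (d / x) ≤ 2 * (√(d : ℝ) / √x) := by
      have h1 := Real.log_le_sub_one_of_pos (show 0 < √(d / x) by positivity)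
      rw [Real.log_sqrt (by positivity), Real.sqrt_div hd0.le] at h1
      linarith
    calc |tscG (tscV a) d| / d * (1 + Real.log (d / x))
        ≤ |tscG (tscV a) d| / d * (2 * (√(d : ℝ) / √x)) := by gcongr
      _ = |tscG (tscV a) d| / (√(d : ℝ) * √(d : ℝ)) * (2 * (√(d : ℝ) / √x)) := by
          rw [Real.mul_self_sqrt hd0.le]
      _ = _ := by field_simp
  · split_ifs <;> positivity

lemma tsc_S1 (a : ℤ) (N : ℕ) :
    ∑ m ∈ (Finset.Icc 1 N).filter (fun m : ℕ => Int.gcd (m : ℤ) a = 1),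
          ((m : ℝ) / (m.totient : ℝ)) =
      ∑ d ∈ Finset.Icc 1 N, tscG (tscV a) d * ((N / d : ℕ) : ℝ) := by
  have h := tsc_swap N (fun d _ => tscG (tscV a) d)
  rw [Finset.sum_filter]
  refine Eq.trans (Finset.sum_congr rfl fun m hm => ?_) (h.trans ?_)
  · exact (tscG_conv a (by have := (Finset.mem_Icc.mp hm).1; lia)).symm
  · refine Finset.sum_congr rfl fun d _ => ?_
    simp [mul_comm]

lemma tsc_S2 (a : ℤ) (N : ℕ) :
    ∑ m ∈ (Finset.Icc 1 N).filter (fun m : ℕ => Int.gcd (m : ℤ) a = 1),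
          (1 / (m.totient : ℝ)) =
      ∑ d ∈ Finset.Icc 1 N, tscG (tscV a) d / d * (harmonic (N / d) : ℝ) := by
  have h := tsc_swap N (fun d k => tscG (tscV a) d / d * (1 / (k : ℝ)))
  rw [Finset.sum_filter]
  refine Eq.trans (Finset.sum_congr rfl fun m hm => ?_) (h.trans ?_)
  · have hm0 : m ≠ 0 := by have := (Finset.mem_Icc.mp hm).1; lia
    have hm1 : (m : ℝ) ≠ 0 := by exact_mod_cast hm0
    have hc := tscG_conv a hm0
    have e : ∑ d ∈ m.divisors, tscG (tscV a) d / d * (1 / ((m / d : ℕ) : ℝ)) =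
        (∑ d ∈ m.divisors, tscG (tscV a) d) / m := by
      rw [Finset.sum_div]
      refine Finset.sum_congr rfl fun d hd => ?_
      have : (m : ℝ) = d * ((m / d : ℕ) : ℝ) := by
        rw [← Nat.cast_mul, Nat.mul_div_cancel' (Nat.dvd_of_mem_divisors hd)]
      conv_rhs => rw [this]
      rw [div_mul_div_comm, mul_one]
    rw [e, hc]
    split_ifs
    · field_simp
    · simp
  · refine Finset.sum_congr rfl fun d _ => ?_
    rw [← Finset.mul_sum, tsc_harm]

lemma tsc_part1 (a : ℤ) (ha : a ≠ 0) (x : ℝ) (hx : 2 ≤ x) (M : ℕ) (hM : ⌊x⌋₊ ≤ M) :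
    |(∑ d ∈ Finset.Icc 1 ⌊x⌋₊, tscG (tscV a) d * ((⌊x⌋₊ / d : ℕ) : ℝ)) -
      x * ∑ d ∈ Finset.Icc 1 M, tscG (tscV a) d / d| ≤
      a.natAbs.divisors.card * (tscC * (1 + Real.log ⌊x⌋₊)) +
        a.natAbs.divisors.card * (tscC * 8) := by
  have hx0 : 0 < x := by linarith
  rw [tsc_split ⌊x⌋₊ M hM, mul_add, ← sub_sub]
  refine (abs_sub _ _).trans (add_le_add ?_ ?_)
  · rw [Finset.mul_sum, ← Finset.sum_sub_distrib]
    refine (Finset.abs_sum_le_sum_abs _ _).trans ((Finset.sum_le_sum fun d hd => ?_).trans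
      (tsc_L1 a ha ⌊x⌋₊))
    have hd0 : (0 : ℝ) < d := by exact_mod_cast (Finset.mem_Icc.mp hd).1
    have e : tscG (tscV a) d * ((⌊x⌋₊ / d : ℕ) : ℝ) - x * (tscG (tscV a) d / d) =
        tscG (tscV a) d * (((⌊x⌋₊ / d : ℕ) : ℝ) - x / d) := by ring
    rw [e, abs_mul, ← Nat.floor_div_natCast]
    refine mul_le_of_le_one_right (abs_nonneg _) ?_
    have h1 := Nat.floor_le (show 0 ≤ x / d by positivity)
    have h2 := Nat.lt_floor_add_one (x / d)
    rw [abs_le]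
    constructor <;> linarith
  · rw [abs_mul, abs_of_pos hx0]
    have h := mul_le_mul_of_nonneg_left (tsc_L3 a ha x hx M) hx0.le
    have e : x * (a.natAbs.divisors.card * (tscC * 8) * x⁻¹) =
        a.natAbs.divisors.card * (tscC * 8) := by field_simp
    rw [e] at h
    refine le_trans (mul_le_mul_of_nonneg_left ?_ hx0.le) h
    refine (Finset.abs_sum_le_sum_abs _ _).trans (Finset.sum_le_sum fun d hd => ?_)
    have hxd : x < d := (Nat.floor_lt hx0.le).mp (Finset.mem_Ioc.mp hd).1
    rw [abs_div, Nat.abs_cast]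
    refine le_mul_of_one_le_right (by positivity) ?_
    have := Real.log_nonneg (show 1 ≤ d / x by rw [one_le_div hx0]; exact hxd.le)
    linarith

lemma tsc_part2 (a : ℤ) (ha : a ≠ 0) (x : ℝ) (hx : 2 ≤ x) (M : ℕ) (hM : ⌊x⌋₊ ≤ M) :
    |(∑ d ∈ Finset.Icc 1 ⌊x⌋₊, tscG (tscV a) d / d * (harmonic (⌊x⌋₊ / d) : ℝ)) -
      ((∑ d ∈ Finset.Icc 1 M, tscG (tscV a) d / d) *
        (Real.log x + Real.eulerMascheroniConstant) -
        ∑ d ∈ Finset.Icc 1 M, tscG (tscV a) d * Real.log d / d)| ≤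
      a.natAbs.divisors.card * (tscC * (1 + Real.log ⌊x⌋₊)) * (2 * x⁻¹) +
        a.natAbs.divisors.card * (tscC * 8) * x⁻¹ := by
  have hx0 : 0 < x := by linarith
  rw [Finset.sum_mul, ← Finset.sum_sub_distrib, tsc_split ⌊x⌋₊ M hM, ← sub_sub]
  refine (abs_sub _ _).trans (add_le_add ?_ ?_)
  · rw [← Finset.sum_sub_distrib]
    refine (Finset.abs_sum_le_sum_abs _ _).trans ?_
    refine le_trans ?_ (mul_le_mul_of_nonneg_right (tsc_L1 a ha ⌊x⌋₊)
      (show 0 ≤ 2 * x⁻¹ by positivity))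
    rw [Finset.sum_mul]
    refine Finset.sum_le_sum fun d hd => ?_
    have hd' := Finset.mem_Icc.mp hd
    have hd0 : (0 : ℝ) < d := by exact_mod_cast hd'.1
    have hdx : (d : ℝ) ≤ x := (Nat.le_floor_iff hx0.le).mp hd'.2
    have hh := tsc_harm_log (x / d) (by rwa [one_le_div hd0])
    rw [Nat.floor_div_natCast, Real.log_div hx0.ne' hd0.ne'] at hh
    have e : tscG (tscV a) d / d * (harmonic (⌊x⌋₊ / d) : ℝ) -
        (tscG (tscV a) d / d * (Real.log x + Real.eulerMascheroniConstant) -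
          tscG (tscV a) d * Real.log d / d) =
        tscG (tscV a) d / d * ((harmonic (⌊x⌋₊ / d) : ℝ) -
          (Real.log x - Real.log d + Real.eulerMascheroniConstant)) := by ring
    rw [e, abs_mul, abs_div, Nat.abs_cast]
    refine (mul_le_mul_of_nonneg_left hh (by positivity)).trans (le_of_eq ?_)
    field_simp
  · refine le_trans ?_ (tsc_L3 a ha x hx M)
    refine (Finset.abs_sum_le_sum_abs _ _).trans (Finset.sum_le_sum fun d hd => ?_)
    have hxd : x < d := (Nat.floor_lt hx0.le).mp (Finset.mem_Ioc.mp hd).1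
    have hd0 : (0 : ℝ) < d := by linarith
    have hl := Real.log_nonneg (show 1 ≤ d / x by rw [one_le_div hx0]; exact hxd.le)
    have e : tscG (tscV a) d / d * (Real.log x + Real.eulerMascheroniConstant) -
          tscG (tscV a) d * Real.log d / d =
        tscG (tscV a) d / d * (Real.eulerMascheroniConstant - Real.log (d / x)) := by
      rw [Real.log_div hd0.ne' hx0.ne']; ring
    rw [e, abs_mul, abs_div, Nat.abs_cast]
    refine mul_le_mul_of_nonneg_left ?_ (by positivity)
    have g1 := Real.one_half_lt_eulerMascheroniConstant
    have g2 := Real.eulerMascheroniConstant_lt_two_thirds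
    rw [abs_le]
    constructor <;> linarith

/-- **Elementary totient sums** (Lemma 5.1): for `a ≠ 0` and `x ≥ 2`,
`Σ_{m ≤ x, (m,a)=1} m/φ(m) = x c₀(a) + O(τ(a) log x)` and
`Σ_{m ≤ x, (m,a)=1} 1/φ(m) = c₀(a)(log x + γ) + c₀′(a) + O(τ(a) x⁻¹ log x)`. -/
theorem totient_sums_coprime :
    ∃ K : ℝ, ∀ (a : ℤ) (x : ℝ), a ≠ 0 → 2 ≤ x →
      |(∑ m ∈ (Finset.Icc 1 ⌊x⌋₊).filter (fun m : ℕ => Int.gcd (m : ℤ) a = 1),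
          ((m : ℝ) / (m.totient : ℝ))) - x * cS 0 a| ≤
        K * (a.natAbs.divisors.card : ℝ) * Real.log x ∧
      |(∑ m ∈ (Finset.Icc 1 ⌊x⌋₊).filter (fun m : ℕ => Int.gcd (m : ℤ) a = 1),
          (1 / (m.totient : ℝ))) -
          (cS 0 a * (Real.log x + Real.eulerMascheroniConstant) + cS' a)| ≤
        K * (a.natAbs.divisors.card : ℝ) * x⁻¹ * Real.log x := by
  refine ⟨22 * tscC, fun a x ha hx => ?_⟩
  have hx0 : 0 < x := by linarith
  have t1 := tsc_tendsto (tsc_hasSum a ha) (by simp)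
  have t2 := tsc_tendsto (tsc_hasSum' a ha) (by simp)
  have hlog2 : 1 / 2 ≤ Real.log x := by
    have := Real.log_two_gt_d9
    have := Real.log_le_log (by norm_num) hx
    linarith
  have hlogN : Real.log (⌊x⌋₊ : ℝ) ≤ Real.log x := by
    refine Real.log_le_log ?_ (Nat.floor_le hx0.le)
    exact_mod_cast Nat.floor_pos.mpr (by linarith)
  have hT : 0 ≤ (a.natAbs.divisors.card : ℝ) * tscC := mul_nonneg (Nat.cast_nonneg _) tscC_nonneg
  have b1 : (a.natAbs.divisors.card : ℝ) * (tscC * (1 + Real.log ⌊x⌋₊)) ≤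
      a.natAbs.divisors.card * tscC * (3 * Real.log x) := by
    rw [← mul_assoc]
    exact mul_le_mul_of_nonneg_left (by linarith) hT
  have b2 : (a.natAbs.divisors.card : ℝ) * (tscC * 8) ≤
      a.natAbs.divisors.card * tscC * (16 * Real.log x) := by
    rw [← mul_assoc]
    exact mul_le_mul_of_nonneg_left (by linarith) hT
  have b3 : 0 ≤ (a.natAbs.divisors.card : ℝ) * tscC * Real.log x :=
    mul_nonneg hT (by linarith)
  constructor
  · rw [tsc_S1]
    have hlim := ((t1.const_mul x).const_sub
      (∑ d ∈ Finset.Icc 1 ⌊x⌋₊, tscG (tscV a) d * ((⌊x⌋₊ / d : ℕ) : ℝ))).abs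
    refine (le_of_tendsto hlim ?_).trans (b := (a.natAbs.divisors.card : ℝ) *
      (tscC * (1 + Real.log ⌊x⌋₊)) + a.natAbs.divisors.card * (tscC * 8)) ?_
    · filter_upwards [Filter.eventually_ge_atTop ⌊x⌋₊] with M hM
      exact tsc_part1 a ha x hx M hM
    · linarith
  · rw [tsc_S2]
    have hlim := (((t1.mul_const (Real.log x + Real.eulerMascheroniConstant)).sub t2).const_sub
      (∑ d ∈ Finset.Icc 1 ⌊x⌋₊, tscG (tscV a) d / d * (harmonic (⌊x⌋₊ / d) : ℝ))).abs
    rw [sub_neg_eq_add] at hlim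
    refine (le_of_tendsto hlim ?_).trans (b := (a.natAbs.divisors.card : ℝ) *
      (tscC * (1 + Real.log ⌊x⌋₊)) * (2 * x⁻¹) +
        a.natAbs.divisors.card * (tscC * 8) * x⁻¹) ?_
    · filter_upwards [Filter.eventually_ge_atTop ⌊x⌋₊] with M hM
      exact tsc_part2 a ha x hx M hM
    · have hxi : 0 ≤ x⁻¹ := by positivity
      have c1 := mul_le_mul_of_nonneg_right b1 (show 0 ≤ 2 * x⁻¹ by positivity)
      have c2 := mul_le_mul_of_nonneg_right b2 hxi
      refine (add_le_add c1 c2).trans (le_of_eq ?_)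
      ring
end
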